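/- Moment matching with a small Gaussian component: Let m₃, m₄ be real numbers with m₄ − m₃² − 1 ≥ 0 and m₄ ≤ C₂ for some constant C₂ > 0, and let ξ^G be a standard Gaussian random variable (mean 0, variance 1). Then for any sufficiently small γ > 0 (depending on C₂) there exists a real random variable ξ_γ, independent of ξ^G and with subexponentially decaying tails, such that the random variable ξ' = (1 − γ)^{1/2} ξ_γ + γ^{1/2} ξ^G satisfies E ξ' = 0, E (ξ')² = 1, E (ξ')³ = m₃, and |E (ξ')⁴ − m₄| ≤ C γ for some constant C depending only on C₂. -/

import Mathlib

open MeasureTheory ProbabilityTheory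

noncomputable section

/-- The moments of a linear combination of two independent variables, by the binomial formula. -/
lemma integral_linear_combination_pow_prod {μ ν : Measure ℝ} [SFinite μ] [SFinite ν]
    (hμ : ∀ k : ℕ, Integrable (fun x ↦ x ^ k) μ) (hν : ∀ k : ℕ, Integrable (fun x ↦ x ^ k) ν)
    (a b : ℝ) (n : ℕ) :
    ∫ z : ℝ × ℝ, (a * z.1 + b * z.2) ^ n ∂(μ.prod ν) =
      ∑ m ∈ Finset.range (n + 1),
        a ^ m * b ^ (n - m) * n.choose m * ((∫ x, x ^ m ∂μ) * ∫ y, y ^ (n - m) ∂ν) := by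
  have hexpand (z : ℝ × ℝ) : (a * z.1 + b * z.2) ^ n = ∑ m ∈ Finset.range (n + 1),
      a ^ m * b ^ (n - m) * n.choose m * (z.1 ^ m * z.2 ^ (n - m)) := by
    rw [add_pow]
    exact Finset.sum_congr rfl fun m _ ↦ by rw [mul_pow, mul_pow]; ring
  simp_rw [hexpand]
  rw [integral_finsetSum _ fun m _ ↦ ((hμ m).mul_prod (hν (n - m))).const_mul _]
  refine Finset.sum_congr rfl fun m _ ↦ ?_
  rw [integral_const_mul, integral_prod_mul (fun x : ℝ ↦ x ^ m) (fun y : ℝ ↦ y ^ (n - m))]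

lemma integrable_pow_gaussianReal (k : ℕ) : Integrable (fun x ↦ x ^ k) (gaussianReal 0 1) := by
  have h := (memLp_id_gaussianReal (μ := 0) (v := 1) k).integrable_norm_pow'
  refine (integrable_norm_iff (by fun_prop)).1 ?_
  simpa [norm_pow] using h

lemma integral_sq_gaussianReal : ∫ x, x ^ 2 ∂gaussianReal 0 1 = 1 := by
  have h := variance_fun_id_gaussianReal (μ := 0) (v := 1)
  rw [variance_eq_integral (by fun_prop)] at h
  simpa using h

lemma integral_cube_gaussianReal : ∫ x, x ^ 3 ∂gaussianReal 0 1 = 0 := by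
  have h : ∫ x, x ^ 3 ∂gaussianReal 0 1 = ∫ x, (-x) ^ 3 ∂gaussianReal 0 1 := by
    conv_lhs => rw [← neg_zero (G := ℝ), ← gaussianReal_map_neg]
    exact integral_map (by fun_prop) (by fun_prop)
  simp only [Odd.neg_pow (by decide : Odd 3), integral_neg] at h
  linarith

/-- A law on three points with mean `0`, variance `1`, third moment `a` and fourth moment
`a ^ 2 + t`: the atoms are `0` and the roots of `x ^ 2 - a * x - t`. -/
lemma exists_compactly_supported_moments (a : ℝ) {t : ℝ} (ht : 1 ≤ t) :
    ∃ μ : Measure ℝ, IsProbabilityMeasure μ ∧ (∃ M : ℝ, ∀ᵐ x ∂μ, |x| ≤ M) ∧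
      (∀ k : ℕ, Integrable (fun x ↦ x ^ k) μ) ∧
      ∫ x, x ∂μ = 0 ∧ ∫ x, x ^ 2 ∂μ = 1 ∧ ∫ x, x ^ 3 ∂μ = a ∧ ∫ x, x ^ 4 ∂μ = a ^ 2 + t := by
  obtain ⟨r, s, hr, hs, hsum, hprod⟩ :
      ∃ r s : ℝ, 0 < r ∧ 0 < s ∧ r - s = a ∧ r * s = t := by
    have hD : Real.sqrt (a ^ 2 + 4 * t) ^ 2 = a ^ 2 + 4 * t := Real.sq_sqrt (by positivity)
    have habs : |a| < Real.sqrt (a ^ 2 + 4 * t) :=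
      Real.lt_sqrt_of_sq_lt (by rw [sq_abs]; linarith)
    obtain ⟨h₁, h₂⟩ := abs_lt.1 habs
    refine ⟨(Real.sqrt (a ^ 2 + 4 * t) + a) / 2, (Real.sqrt (a ^ 2 + 4 * t) - a) / 2,
      by linarith, by linarith, by ring, by linarith⟩
  have hrs : 0 < r + s := by positivity
  set p : ℝ := 1 / (r * (r + s)) with hp
  set q : ℝ := 1 / (s * (r + s)) with hq
  have hp0 : 0 ≤ p := by positivity
  have hq0 : 0 ≤ q := by positivity
  have hpq : p + q = 1 / t := by rw [hp, hq, ← hprod]; field_simp; ring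
  have hw0 : 0 ≤ 1 - p - q := by
    have : 1 / t ≤ 1 := by rw [div_le_one (by linarith)]; exact ht
    linarith
  let μ : Measure ℝ := ENNReal.ofReal (1 - p - q) • Measure.dirac 0 +
    (ENNReal.ofReal p • Measure.dirac r + ENNReal.ofReal q • Measure.dirac (-s))
  have hatom (f : ℝ → ℝ) (w x : ℝ) :
      Integrable f (ENNReal.ofReal w • Measure.dirac x) :=
    (integrable_dirac (by simp)).smul_measure ENNReal.ofReal_ne_top
  have hint (f : ℝ → ℝ) : Integrable f μ :=
    (hatom f _ _).add_measure ((hatom f _ _).add_measure (hatom f _ _))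
  have hval (f : ℝ → ℝ) : ∫ x, f x ∂μ = (1 - p - q) * f 0 + (p * f r + q * f (-s)) := by
    rw [integral_add_measure (hatom f _ _) ((hatom f _ _).add_measure (hatom f _ _)),
      integral_add_measure (hatom f _ _) (hatom f _ _)]
    simp [ENNReal.toReal_ofReal, hp0, hq0, hw0]
  refine ⟨μ, ⟨?_⟩, ⟨max r s, ?_⟩, fun k ↦ hint _, ?_, ?_, ?_, ?_⟩
  · simp only [μ, Measure.add_apply, Measure.smul_apply, measure_univ, smul_eq_mul, mul_one]
    rw [← ENNReal.ofReal_add hp0 hq0, ← ENNReal.ofReal_add hw0 (by positivity)]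
    ring_nf
    simp
  · have hdirac (w x : ℝ) (hx : |x| ≤ max r s) :
        ∀ᵐ y ∂(ENNReal.ofReal w • Measure.dirac x), |y| ≤ max r s :=
      Measure.ae_smul_measure (by simpa [ae_dirac_eq] using hx) _
    simp only [μ, ae_add_measure_iff]
    refine ⟨hdirac _ _ ?_, hdirac _ _ ?_, hdirac _ _ ?_⟩
    · simp [hr.le]
    · simp [abs_of_pos hr]
    · simp [abs_of_pos hs]
  all_goals
    rw [hval, hp, hq]
    try rw [← hsum]
    try rw [← hprod]
    field_simp
    ring

/-- An almost surely bounded random variable has exponentially decaying tails. -/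
lemma measure_le_abs_le_exp_of_bounded {Ω : Type*} [MeasurableSpace Ω] {P : Measure Ω}
    [IsProbabilityMeasure P] {X : Ω → ℝ} {M : ℝ} (hX : ∀ᵐ ω ∂P, |X ω| ≤ M) (s : ℝ) :
    P {ω | s ≤ |X ω|} ≤ ENNReal.ofReal (Real.exp M * Real.exp (-s)) := by
  rcases le_or_gt s M with h | h
  · refine prob_le_one.trans ?_
    rw [← Real.exp_add, ENNReal.one_le_ofReal, Real.one_le_exp_iff]
    linarith
  · have h₀ : P {ω | s ≤ |X ω|} = 0 :=
      measure_mono_null (fun ω hω ↦ not_le.2 (h.trans_le hω)) (ae_iff.1 hX)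
    simp [h₀]

/-- **Moment matching with a small Gaussian component.** Let `m₃, m₄` be real numbers
with `m₄ - m₃² - 1 ≥ 0` and `m₄ ≤ C₂`. Then for any sufficiently small `γ > 0`
(depending on `C₂`) there is a probability space carrying a standard Gaussian `ξᴳ`
and an independent real random variable `ξ_γ` with subexponentially decaying tails
such that `ξ' = (1-γ)^{1/2} ξ_γ + γ^{1/2} ξᴳ` satisfies `E ξ' = 0`, `E ξ'² = 1`,
`E ξ'³ = m₃` and `|E ξ'⁴ - m₄| ≤ C γ` for some `C` depending only on `C₂`. -/
theorem moment_matching_gaussian_component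
    (C₂ : ℝ) (hC₂ : 0 < C₂) :
    ∃ γ₀ C : ℝ, 0 < γ₀ ∧ 0 < C ∧
      ∀ m₃ m₄ : ℝ, 0 ≤ m₄ - m₃ ^ 2 - 1 → m₄ ≤ C₂ →
      ∀ γ : ℝ, 0 < γ → γ ≤ γ₀ →
      ∃ (Ω : Type) (_ : MeasureSpace Ω) (_ : IsProbabilityMeasure (ℙ : Measure Ω))
        (ξγ ξG : Ω → ℝ),
        Measurable ξγ ∧ Measurable ξG ∧
        -- ξG is a standard Gaussian
        Measure.map ξG ℙ = gaussianReal 0 1 ∧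
        -- ξγ is independent of ξG
        IndepFun ξγ ξG ℙ ∧
        -- ξγ has subexponentially decaying tails
        (∃ Cs θs : ℝ, 0 < Cs ∧ 0 < θs ∧ ∀ s : ℝ, 1 ≤ s →
          ℙ {ω | s ≤ |ξγ ω|} ≤ ENNReal.ofReal (Cs * Real.exp (-(s ^ θs)))) ∧
        -- moments of ξ' = (1-γ)^{1/2} ξγ + γ^{1/2} ξG
        (∫ ω, (Real.sqrt (1 - γ) * ξγ ω + Real.sqrt γ * ξG ω) ∂ℙ = 0) ∧
        (∫ ω, (Real.sqrt (1 - γ) * ξγ ω + Real.sqrt γ * ξG ω) ^ 2 ∂ℙ = 1) ∧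
        (∫ ω, (Real.sqrt (1 - γ) * ξγ ω + Real.sqrt γ * ξG ω) ^ 3 ∂ℙ = m₃) ∧
        |(∫ ω, (Real.sqrt (1 - γ) * ξγ ω + Real.sqrt γ * ξG ω) ^ 4 ∂ℙ) - m₄|
          ≤ C * γ := by
  set g : ℝ := ∫ x, x ^ 4 ∂gaussianReal 0 1
  refine ⟨1 / 2, 4 * C₂ + 6 + |g|, by norm_num, by positivity, fun m₃ m₄ hm hm₄ γ hγ hγ₀ ↦ ?_⟩
  have hγ₁ : 0 < 1 - γ := by linarith
  set u := Real.sqrt (1 - γ)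
  set v := Real.sqrt γ
  have hu : 0 < u := Real.sqrt_pos.2 hγ₁
  have hu2 : u ^ 2 = 1 - γ := Real.sq_sqrt hγ₁.le
  have hv2 : v ^ 2 = γ := Real.sq_sqrt hγ.le
  obtain ⟨μ, hμ, ⟨M, hM⟩, hint, h₁, h₂, h₃, h₄⟩ :=
    exists_compactly_supported_moments (m₃ / u ^ 3) (t := m₄ - m₃ ^ 2) (by linarith)
  have hmoment := integral_linear_combination_pow_prod hint integrable_pow_gaussianReal u v
  refine ⟨ℝ × ℝ, ⟨μ.prod (gaussianReal 0 1)⟩, ?_, Prod.fst, Prod.snd, measurable_fst,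
    measurable_snd, ?_, ?_, ⟨Real.exp M, 1, Real.exp_pos M, one_pos, fun s _ ↦ ?_⟩, ?_, ?_, ?_, ?_⟩
  · exact inferInstanceAs (IsProbabilityMeasure (μ.prod (gaussianReal 0 1)))
  · change Measure.map Prod.snd (μ.prod (gaussianReal 0 1)) = gaussianReal 0 1
    simp [Measure.map_snd_prod]
  · exact indepFun_prod (μ := μ) (ν := gaussianReal 0 1) measurable_id measurable_id
  · rw [Real.rpow_one]
    exact measure_le_abs_le_exp_of_bounded (P := μ.prod (gaussianReal 0 1))
      (Measure.quasiMeasurePreserving_fst.ae hM) s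
  · have h := hmoment 1
    simp only [pow_one] at h
    refine h.trans ?_
    simp [Finset.sum_range_succ, h₁, integral_id_gaussianReal]
  · refine (hmoment 2).trans ?_
    simp [Finset.sum_range_succ, h₁, h₂, integral_id_gaussianReal, integral_sq_gaussianReal]
    linarith
  · refine (hmoment 3).trans ?_
    simp [Finset.sum_range_succ, h₁, h₂, h₃, integral_id_gaussianReal, integral_sq_gaussianReal,
      integral_cube_gaussianReal]
    field_simp
  · have hE : ∫ z : ℝ × ℝ, (u * z.1 + v * z.2) ^ 4 ∂(μ.prod (gaussianReal 0 1)) =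
        u ^ 4 * ((m₃ / u ^ 3) ^ 2 + (m₄ - m₃ ^ 2)) + 6 * u ^ 2 * v ^ 2 + v ^ 4 * g := by
      rw [hmoment 4]
      simp [Finset.sum_range_succ, h₁, h₂, h₃, h₄, integral_id_gaussianReal,
        integral_sq_gaussianReal, integral_cube_gaussianReal, Nat.choose, g]
      ring
    have hdiff : u ^ 4 * ((m₃ / u ^ 3) ^ 2 + (m₄ - m₃ ^ 2)) + 6 * u ^ 2 * v ^ 2 + v ^ 4 * g - m₄
        = γ * (m₃ ^ 2 / (1 - γ) - (2 - γ) * (m₄ - m₃ ^ 2) + 6 * (1 - γ) + γ * g) := by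
      have hu4 : u ^ 4 * (m₃ / u ^ 3) ^ 2 = m₃ ^ 2 / (1 - γ) := by
        rw [← hu2]; field_simp
      rw [mul_add, hu4, show u ^ 4 = (u ^ 2) ^ 2 by ring, show v ^ 4 = (v ^ 2) ^ 2 by ring,
        hu2, hv2]
      field_simp
      ring
    have hbound : |m₃ ^ 2 / (1 - γ) - (2 - γ) * (m₄ - m₃ ^ 2) + 6 * (1 - γ) + γ * g|
        ≤ 4 * C₂ + 6 + |g| := by
      have hm₃ : m₃ ^ 2 / (1 - γ) ≤ 2 * C₂ := by
        rw [div_le_iff₀ hγ₁]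
        nlinarith
      have hm₃' : 0 ≤ m₃ ^ 2 / (1 - γ) := by positivity
      have hg : |γ * g| ≤ |g| := by
        rw [abs_mul, abs_of_pos hγ]
        nlinarith [abs_nonneg g]
      obtain ⟨hg₁, hg₂⟩ := abs_le.1 hg
      have hslack : (2 - γ) * (m₄ - m₃ ^ 2) ≤ 2 * C₂ := by nlinarith [sq_nonneg m₃]
      have hslack' : 0 ≤ (2 - γ) * (m₄ - m₃ ^ 2) := mul_nonneg (by linarith) (by linarith)
      rw [abs_le]
      constructor <;> linarith
    change |(∫ z : ℝ × ℝ, (u * z.1 + v * z.2) ^ 4 ∂(μ.prod (gaussianReal 0 1))) - m₄| ≤ _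
    rw [hE, hdiff, abs_mul, abs_of_pos hγ, mul_comm]
    exact mul_le_mul_of_nonneg_right hbound hγ.le
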